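/- Let E be a finite-dimensional real normed vector space, C ⊆ E a closed convex cone satisfying C ∩ (−C) = {0}, and T : E → E a linear map with T(C) ⊆ C. If v lies in the interior of C, then there exists a constant c > 0 such that ‖Tⁿ v‖ ≥ c·‖Tⁿ‖ for every n ≥ 1; consequently ‖Tⁿ v‖ and the operator norm ‖Tⁿ‖ have the same growth rate. -/

import Mathlib

open Metric in
/-- A closed strict cone in a finite-dimensional normed space is normal: the norm of an element
of the cone is controlled by the norm of any larger element. -/
theorem exists_pos_mul_norm_le_norm_add_of_strict_cone
    {E : Type*} [NormedAddCommGroup E] [NormedSpace ℝ E] [FiniteDimensional ℝ E]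
    {C : Set E} (hC_closed : IsClosed C)
    (hC_cone : ∀ t : ℝ, 0 ≤ t → ∀ x ∈ C, t • x ∈ C)
    (hC_strict : C ∩ (-C) = {0}) :
    ∃ δ : ℝ, 0 < δ ∧ ∀ a ∈ C, ∀ b ∈ C, δ * ‖a‖ ≤ ‖a + b‖ := by
  have : ProperSpace E := FiniteDimensional.proper ℝ E
  have h0 : (0 : E) ∈ C := (hC_strict.symm ▸ Set.mem_singleton (0 : E) : _ ∈ C ∩ (-C)).1
  have hcompact : IsCompact (sphere (0 : E) 1 ∩ C) := (isCompact_sphere 0 1).inter_right hC_closed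
  have hunit : ∃ δ : ℝ, 0 < δ ∧ ∀ a ∈ sphere (0 : E) 1 ∩ C, δ ≤ infDist (-a) C := by
    have hcont : Continuous fun a : E => infDist (-a) C :=
      (continuous_infDist_pt C).comp continuous_neg
    rcases (sphere (0 : E) 1 ∩ C).eq_empty_or_nonempty with he | hne
    · exact ⟨1, one_pos, by simp [he]⟩
    · obtain ⟨a, ha, hmin⟩ := hcompact.exists_isMinOn hne hcont.continuousOn
      refine ⟨infDist (-a) C, ?_, fun x hx => hmin hx⟩
      refine (hC_closed.notMem_iff_infDist_pos ⟨0, h0⟩).1 fun hna => ?_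
      have ha0 : a ∈ ({0} : Set E) := hC_strict ▸ ⟨ha.2, hna⟩
      have ha1 := ha.1
      rw [Set.mem_singleton_iff.1 ha0] at ha1
      simp at ha1
  obtain ⟨δ, hδ, hδC⟩ := hunit
  refine ⟨δ, hδ, fun a ha b hb => ?_⟩
  rcases eq_or_ne a 0 with rfl | hne
  · simp
  have hpos : 0 < ‖a‖ := norm_pos_iff.2 hne
  have hinv : 0 ≤ ‖a‖⁻¹ := inv_nonneg.2 hpos.le
  have hle : δ ≤ dist (-(‖a‖⁻¹ • a)) (‖a‖⁻¹ • b) :=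
    (hδC _ ⟨by simp [norm_smul, hpos.ne'], hC_cone _ hinv a ha⟩).trans
      (infDist_le_dist_of_mem (hC_cone _ hinv b hb))
  rw [dist_eq_norm, ← norm_neg, neg_sub, sub_neg_eq_add, ← smul_add, norm_smul,
    Real.norm_of_nonneg hinv, inv_mul_eq_div, le_div_iff₀ hpos, add_comm b a] at hle
  exact hle

/-- If `T` preserves a closed convex strict cone `C` and `v` is an interior point of `C`,
then `‖Tⁿ v‖ ≥ c·‖Tⁿ‖` for some `c > 0` and all `n ≥ 1`: the growth of `‖Tⁿ v‖`
dominates (a fixed multiple of) the operator norm `‖Tⁿ‖`. -/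
theorem interior_vector_dominates_operator_norm
    (E : Type*) [NormedAddCommGroup E] [NormedSpace ℝ E] [FiniteDimensional ℝ E]
    (C : Set E) (hC_closed : IsClosed C) (hC_convex : Convex ℝ C)
    (hC_cone : ∀ t : ℝ, 0 ≤ t → ∀ x ∈ C, t • x ∈ C)
    (hC_strict : C ∩ (-C) = {0})
    (T : E →L[ℝ] E) (hT : ∀ x ∈ C, T x ∈ C)
    (v : E) (hv : v ∈ interior C) :
    ∃ c : ℝ, 0 < c ∧ ∀ n : ℕ, 1 ≤ n → c * ‖T ^ n‖ ≤ ‖(T ^ n) v‖ := by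
  obtain ⟨δ, hδ, hδC⟩ := exists_pos_mul_norm_le_norm_add_of_strict_cone hC_closed hC_cone hC_strict
  obtain ⟨r, hr, hrC⟩ := Metric.nhds_basis_closedBall.mem_iff.1 (mem_interior_iff_mem_nhds.1 hv)
  refine ⟨r * δ / (2 + δ), by positivity, fun n _ => ?_⟩
  have hTn : ∀ x ∈ C, (T ^ n) x ∈ C := by
    intro x hx
    clear * - hT hx
    induction n with
    | zero => simpa using hx
    | succ k ih =>
      rw [pow_succ']
      exact hT _ ih
  have hball : ∀ x : E, ‖x‖ ≤ r → δ * ‖(T ^ n) x‖ ≤ (2 + δ) * ‖(T ^ n) v‖ := by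
    intro x hx
    have hadd := hTn (v + x) (hrC (by simpa using hx))
    have hsub := hTn (v - x) (hrC (by simpa [dist_eq_norm] using hx))
    have hnormal := hδC _ hadd _ hsub
    have hsum : (T ^ n) (v + x) + (T ^ n) (v - x) = (2 : ℝ) • (T ^ n) v := by
      rw [← map_add, ← map_smul, two_smul]
      congr 1
      abel
    rw [hsum, norm_smul, Real.norm_two, map_add] at hnormal
    have htri : ‖(T ^ n) x‖ ≤ ‖(T ^ n) v + (T ^ n) x‖ + ‖(T ^ n) v‖ := by
      simpa using norm_sub_le ((T ^ n) v + (T ^ n) x) ((T ^ n) v)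
    nlinarith [mul_le_mul_of_nonneg_left htri hδ.le]
  have hop : ‖T ^ n‖ ≤ (2 + δ) * ‖(T ^ n) v‖ / (r * δ) := by
    refine ContinuousLinearMap.opNorm_le_bound _ (by positivity) fun x => ?_
    rcases eq_or_ne x 0 with rfl | hne
    · simp
    have hpos : 0 < ‖x‖ := norm_pos_iff.2 hne
    have hscale : ‖(r / ‖x‖) • x‖ = r := by
      rw [norm_smul, Real.norm_of_nonneg (by positivity), div_mul_cancel₀ _ hpos.ne']
    have hb := hball _ hscale.le
    rw [map_smul, norm_smul, Real.norm_of_nonneg (by positivity)] at hb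
    rw [div_mul_eq_mul_div, le_div_iff₀ (by positivity)]
    calc ‖(T ^ n) x‖ * (r * δ) = δ * (r / ‖x‖ * ‖(T ^ n) x‖) * ‖x‖ := by field_simp
      _ ≤ (2 + δ) * ‖(T ^ n) v‖ * ‖x‖ := by gcongr
  rw [le_div_iff₀ (by positivity)] at hop
  rw [div_mul_eq_mul_div, div_le_iff₀ (by positivity)]
  linarith
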